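/- arXiv:1209.6019 — 2 statements merged into one kernel-verified Lean document; each statement's English description precedes it below -/
import Mathlib

section
/- The promotion map cyclically shifts the content: defining the content (r_1,…,r_{n+1}) of A ∈ B^{m,i} by r_k = m − Σ_{q=i}^{n} a_{k,q} for 1 ≤ k ≤ i and r_k = Σ_{p=1}^{i} a_{p,k−1} for i+1 ≤ k ≤ n+1, the content of pr(A) is (r_{n+1}, r_1, r_2, …, r_n). -/
open Finset

namespace KR

/-- Arrays of integers indexed by (column, row). -/
abbrev Arr := ℕ → ℕ → ℤ

/-- A Dyck path from (1,i) to (i,n). -/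
def IsDyck (n i : ℕ) (L : List (ℕ × ℕ)) : Prop :=
  L ≠ [] ∧ L.head? = some (1, i) ∧ L.getLast? = some (i, n) ∧
    L.Chain' (fun β γ => γ = (β.1, β.2 + 1) ∨ γ = (β.1 + 1, β.2))

/-- Membership in the polytope `B^{m,i}`: nonnegative entries supported on the box
`1 ≤ p ≤ i`, `i ≤ q ≤ n`, with all Dyck path sums bounded by `m`. -/
def InB (n i m : ℕ) (A : Arr) : Prop :=
  (∀ p q, 1 ≤ p → p ≤ i → i ≤ q → q ≤ n → 0 ≤ A p q) ∧
  (∀ p q, ¬(1 ≤ p ∧ p ≤ i ∧ i ≤ q ∧ q ≤ n) → A p q = 0) ∧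
  (∀ L, IsDyck n i L → (L.map fun β => A β.1 β.2).sum ≤ (m : ℤ))

/-- The sum `Σ_{j=1}^{p} a_{j,l−1} + Σ_{j=p}^{i} a_{j,l}` (used for `l > i`). -/
def Fp (i : ℕ) (A : Arr) (l p : ℕ) : ℤ :=
  ∑ j ∈ Icc 1 p, A j (l - 1) + ∑ j ∈ Icc p i, A j l

/-- `p_+^l(A)`: minimal maximizer of `Fp` on `{1,…,i}`. -/
noncomputable def pplus (i : ℕ) (A : Arr) (l : ℕ) : ℕ :=
  sInf {p | p ∈ Icc 1 i ∧ ∀ q ∈ Icc 1 i, Fp i A l q ≤ Fp i A l p}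

/-- `q_+^l(A)`: maximal maximizer of `Fp` on `{1,…,i}`. -/
noncomputable def qplus (i : ℕ) (A : Arr) (l : ℕ) : ℕ :=
  sSup {p | p ∈ Icc 1 i ∧ ∀ q ∈ Icc 1 i, Fp i A l q ≤ Fp i A l p}

/-- The sum `Σ_{j=i}^{p} a_{l,j} + Σ_{j=p}^{n} a_{l+1,j}` (used for `l < i`). -/
def Fm (n i : ℕ) (A : Arr) (l p : ℕ) : ℤ :=
  ∑ j ∈ Icc i p, A l j + ∑ j ∈ Icc p n, A (l + 1) j

/-- `p_−^l(A)`: maximal maximizer of `Fm` on `{i,…,n}`. -/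
noncomputable def pminus (n i : ℕ) (A : Arr) (l : ℕ) : ℕ :=
  sSup {p | p ∈ Icc i n ∧ ∀ q ∈ Icc i n, Fm n i A l q ≤ Fm n i A l p}

/-- `q_−^l(A)`: minimal maximizer of `Fm` on `{i,…,n}`. -/
noncomputable def qminus (n i : ℕ) (A : Arr) (l : ℕ) : ℕ :=
  sInf {p | p ∈ Icc i n ∧ ∀ q ∈ Icc i n, Fm n i A l q ≤ Fm n i A l p}

/-- `φ_l(A)` (depending on the parameter `m` only when `l = i`). -/
noncomputable def phi (n i m : ℕ) (l : ℕ) (A : Arr) : ℤ :=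
  if l = i then (m : ℤ) - ∑ j ∈ Icc 1 (i - 1), A j i - ∑ j ∈ Icc i n, A i j
  else if i < l then
    ∑ j ∈ Icc 1 (pplus i A l), A j (l - 1) - ∑ j ∈ Icc 1 (pplus i A l - 1), A j l
  else
    ∑ j ∈ Icc (pminus n i A l) n, A (l + 1) j - ∑ j ∈ Icc (pminus n i A l + 1) n, A l j

/-- `ε_l(A)` (the parameter `m` is carried along for uniformity; it is not used). -/
noncomputable def eps (n i m : ℕ) (l : ℕ) (A : Arr) : ℤ :=
  if l = i then A i i
  else if i < l then
    ∑ j ∈ Icc (qplus i A l) i, A j l - ∑ j ∈ Icc (qplus i A l + 1) i, A j (l - 1)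
  else
    ∑ j ∈ Icc i (qminus n i A l), A l j - ∑ j ∈ Icc i (qminus n i A l - 1), A (l + 1) j

/-- Update a single entry of an array. -/
def upd (A : Arr) (p q : ℕ) (v : ℤ) : Arr :=
  fun p' q' => if p' = p ∧ q' = q then v else A p' q'

/-- The Kashiwara operator `f_l` (with `none` playing the role of `0`). -/
noncomputable def fop (n i m : ℕ) (l : ℕ) (A : Arr) : Option Arr :=
  if phi n i m l A = 0 then none
  else some <|
    if l = i then upd A i i (A i i + 1)
    else if i < l then
      upd (upd A (pplus i A l) (l - 1) (A (pplus i A l) (l - 1) - 1))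
        (pplus i A l) l (A (pplus i A l) l + 1)
    else
      upd (upd A l (pminus n i A l) (A l (pminus n i A l) + 1))
        (l + 1) (pminus n i A l) (A (l + 1) (pminus n i A l) - 1)

/-- The Kashiwara operator `e_l` (with `none` playing the role of `0`). -/
noncomputable def eop (n i m : ℕ) (l : ℕ) (A : Arr) : Option Arr :=
  if eps n i m l A = 0 then none
  else some <|
    if l = i then upd A i i (A i i - 1)
    else if i < l then
      upd (upd A (qplus i A l) (l - 1) (A (qplus i A l) (l - 1) + 1))
        (qplus i A l) l (A (qplus i A l) l - 1)
    else
      upd (upd A l (qminus n i A l) (A l (qminus n i A l) - 1))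
        (l + 1) (qminus n i A l) (A (l + 1) (qminus n i A l) + 1)

/-- Coefficient of `ω_j` in the simple root `α_r` (column `r` of the Cartan matrix). -/
def cart (j r : ℕ) : ℤ :=
  if r = j then 2 else if r = j + 1 ∨ j = r + 1 then -1 else 0

/-- The weight `wt(A) = mω_i − Σ a_{p,q} α_{p,q}`, expressed in the basis of
fundamental weights: `wtv n i m A j` is the coefficient of `ω_j`. -/
def wtv (n i m : ℕ) (A : Arr) (j : ℕ) : ℤ :=
  (m : ℤ) * (if j = i then 1 else 0) -
    ∑ p ∈ Icc 1 i, ∑ q ∈ Icc i n, A p q * ∑ r ∈ Icc p q, cart j r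

/-- The coefficient `c_l(p,q)` of the pairing `⟨α_l^∨, α_{p,q}⟩`. -/
def clpq (l p q : ℕ) : ℤ :=
  if p = l ∧ q = l then 2
  else if (l = p ∧ p < q) ∨ (p < q ∧ q = l) then 1
  else if l + 1 = p ∨ l = q + 1 then -1
  else 0

/-- The pairing `⟨α_l^∨, wt(A)⟩ = m·δ_{l,i} − Σ_{p,q} a_{p,q}·c_l(p,q)`. -/
def pairing (n i m : ℕ) (l : ℕ) (A : Arr) : ℤ :=
  (m : ℤ) * (if l = i then 1 else 0) -
    ∑ p ∈ Icc 1 i, ∑ q ∈ Icc i n, A p q * clpq l p q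

/-! ### The promotion algorithm -/

/-- Columns, indexed by rows `i,…,n`. -/
abbrev Col := ℕ → ℤ

/-- `Σ_{j=lo}^{p} a_j + Σ_{j=p}^{n} b_j`. -/
def Gc (n lo : ℕ) (a b : Col) (p : ℕ) : ℤ := ∑ j ∈ Icc lo p, a j + ∑ j ∈ Icc p n, b j

/-- `q_−` for two (truncated) columns with rows `lo,…,n`: the minimal maximizer of `Gc`. -/
noncomputable def qmc (n lo : ℕ) (a b : Col) : ℕ :=
  if lo ≤ n then
    max lo (sInf {p | p ∈ Icc lo n ∧ ∀ q ∈ Icc lo n, Gc n lo a b q ≤ Gc n lo a b p})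
  else n

/-- `ε` for two (truncated) columns with rows `lo,…,n`. -/
noncomputable def epsc (n lo : ℕ) (a b : Col) : ℤ :=
  ∑ j ∈ Icc lo (qmc n lo a b), a j - ∑ j ∈ Icc lo (qmc n lo a b - 1), b j

/-- The sequence `l_1 < l_2 < ⋯` of the promotion algorithm:
`l_1 = q_−(a,c)` and `l_{s+1} = q_−((a)^{≥ l_s + 1}, (c)^{≥ l_s + 1})`,
stabilizing at `n`. -/
noncomputable def lfun (n i : ℕ) (a c : Col) : ℕ → ℕ
  | 0 => qmc n i a c
  | s + 1 => qmc n (lfun n i a c s + 1) a c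

/-- The set `{l_1, …, l_t}` (with `l_t = n`). -/
noncomputable def lset (n i : ℕ) (a c : Col) : Finset ℕ := (Finset.range (n + 1)).image (lfun n i a c)

/-- The new column `ĉ` of formula (6.2). -/
noncomputable def hatc (n i : ℕ) (a c : Col) : Col := fun r =>
  if r = n then a n + c n
  else if r ∈ lset n i a c then a r + c r - epsc n (r + 1) a c
  else a r

/-- The output column of one step of the promotion algorithm. -/
noncomputable def prcol (n i : ℕ) (a c : Col) : Col := fun r =>
  if r = i then epsc n i a c
  else if r - 1 ∈ lset n i a c then epsc n r a c
  else c (r - 1)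

/-- The running columns of the promotion algorithm: `cseq 0` is the `i`-th column of `A`,
and `cseq (k+1)` is obtained from the `(i−1−k)`-th column of `A` and `cseq k`. -/
noncomputable def cseq (n i : ℕ) (A : Arr) : ℕ → Col
  | 0 => fun r => A i r
  | k + 1 => hatc n i (fun r => A (i - 1 - k) r) (cseq n i A k)

/-- The `j`-th column of `pr(A)` for `2 ≤ j ≤ i`. -/
noncomputable def prColJ (n i : ℕ) (A : Arr) (j : ℕ) : Col :=
  prcol n i (fun q => A (j - 1) q) (cseq n i A (i - j))

/-- The promotion map `pr` on `B^{m,i}`. -/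
noncomputable def prMap (n i m : ℕ) (A : Arr) : Arr := fun p r =>
  if 1 ≤ p ∧ p ≤ i ∧ i ≤ r ∧ r ≤ n then
    if p = 1 then
      if r = i then
        (m : ℤ) - (∑ j ∈ Icc i n, A i j) - ∑ j ∈ Icc 2 i, prColJ n i A j i
      else
        (∑ j ∈ Icc 1 i, A j (r - 1)) - ∑ j ∈ Icc 2 i, prColJ n i A j r
    else prColJ n i A p r
  else 0

/-- The content `(r_1,…,r_{n+1})` of an array. -/
def cont (n i m : ℕ) (A : Arr) (k : ℕ) : ℤ :=
  if k ≤ i then (m : ℤ) - ∑ q ∈ Icc i n, A k q else ∑ p ∈ Icc 1 i, A p (k - 1)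

theorem qmc_le (n lo : ℕ) (a b : Col) : qmc n lo a b ≤ n := by
  unfold qmc
  split_ifs with h
  · obtain ⟨p, hp, hmax⟩ := exists_max_image (Icc lo n) (Gc n lo a b) ⟨lo, by simp [h]⟩
    have hmem := Nat.sInf_mem
      (s := {p | p ∈ Icc lo n ∧ ∀ q ∈ Icc lo n, Gc n lo a b q ≤ Gc n lo a b p}) ⟨p, hp, hmax⟩
    exact max_le h (mem_Icc.1 hmem.1).2
  · exact le_rfl

theorem le_qmc {n lo : ℕ} (h : lo ≤ n) (a b : Col) : lo ≤ qmc n lo a b := by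
  simp [qmc, h]

theorem qmc_of_lt {n lo : ℕ} (h : n < lo) (a b : Col) : qmc n lo a b = n := by
  simp [qmc, h]

theorem lfun_le (n i : ℕ) (a c : Col) : ∀ s, lfun n i a c s ≤ n
  | 0 => qmc_le ..
  | _ + 1 => qmc_le ..

theorem lfun_lt_succ {n i : ℕ} {a c : Col} {s : ℕ} (h : lfun n i a c s < n) :
    lfun n i a c s < lfun n i a c (s + 1) :=
  le_qmc (Nat.succ_le_of_lt h) a c

theorem lfun_succ_of_eq {n i : ℕ} {a c : Col} {s : ℕ} (h : lfun n i a c s = n) :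
    lfun n i a c (s + 1) = n := by
  rw [lfun, h, qmc_of_lt (Nat.lt_succ_self n)]

theorem lfun_monotone (n i : ℕ) (a c : Col) : Monotone (lfun n i a c) := by
  refine monotone_nat_of_le_succ fun s => ?_
  rcases (lfun_le n i a c s).lt_or_eq with h | h
  · exact (lfun_lt_succ h).le
  · rw [lfun_succ_of_eq h, h]

theorem min_le_lfun (n i : ℕ) (a c : Col) (s : ℕ) : min n s ≤ lfun n i a c s := by
  induction s with
  | zero => simp
  | succ s ih =>
    rcases (lfun_le n i a c s).lt_or_eq with h | h
    · have := lfun_lt_succ h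
      omega
    · rw [lfun_succ_of_eq h]
      exact min_le_left ..

theorem lfun_self (n i : ℕ) (a c : Col) : lfun n i a c n = n :=
  le_antisymm (lfun_le ..) (by simpa using min_le_lfun n i a c n)

theorem sum_Icc_add_sum_Icc_succ {lo mid hi : ℕ} (h₁ : lo ≤ mid + 1) (h₂ : mid ≤ hi) (f : ℕ → ℤ) :
    ∑ r ∈ Icc lo mid, f r + ∑ r ∈ Icc (mid + 1) hi, f r = ∑ r ∈ Icc lo hi, f r := by
  simp only [← Ico_succ_right_eq_Icc, Nat.succ_eq_succ, Nat.succ_eq_add_one]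
  exact sum_Ico_consecutive f h₁ (by omega)

/-- A sum over `lo + 1, …, q` of a shifted function, reindexed. -/
theorem sum_Icc_succ_sub_one {lo q : ℕ} (hlo : 1 ≤ lo) (h : lo ≤ q) (f : ℕ → ℤ) :
    ∑ r ∈ Icc (lo + 1) q, f (r - 1) = ∑ r ∈ Icc lo (q - 1), f r := by
  refine sum_bij' (fun r _ => r - 1) (fun r _ => r + 1) ?_ ?_ ?_ ?_ ?_ <;>
    intro r hr <;> simp only [mem_Icc] at hr ⊢ <;> omega

/-- On a block `lo, …, q_−` whose rows before the last avoid `lset`, the output column and the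
input column have the same sum. -/
theorem sum_prcol_block {n i lo : ℕ} {a c : Col} (hi1 : 1 ≤ i) (hi : i ≤ lo)
    (hlo : lo ≤ n) (h₀ : prcol n i a c lo = epsc n lo a c)
    (havoid : ∀ r, lo ≤ r → r < qmc n lo a c → r ∉ lset n i a c) :
    ∑ r ∈ Icc lo (qmc n lo a c), prcol n i a c r = ∑ r ∈ Icc lo (qmc n lo a c), a r := by
  have hq := le_qmc hlo a c
  have hrest : ∑ r ∈ Icc (lo + 1) (qmc n lo a c), prcol n i a c r
      = ∑ r ∈ Icc lo (qmc n lo a c - 1), c r := by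
    rw [← sum_Icc_succ_sub_one (hi1.trans hi) hq]
    refine sum_congr rfl fun r hr => ?_
    rw [mem_Icc] at hr
    rw [prcol, if_neg (by omega), if_neg (havoid _ (by omega) (by omega))]
  rw [← sum_Icc_add_sum_Icc_succ (Nat.le_succ lo) hq, hrest, Icc_self, sum_singleton, h₀, epsc]
  ring

theorem sum_prcol_lfun {n i : ℕ} (hi1 : 1 ≤ i) (hin : i ≤ n) (a c : Col) (s : ℕ)
    (hs : s ≤ n) :
    ∑ r ∈ Icc i (lfun n i a c s), prcol n i a c r = ∑ r ∈ Icc i (lfun n i a c s), a r := by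
  have hmono := lfun_monotone n i a c
  induction s with
  | zero =>
    refine sum_prcol_block hi1 le_rfl hin (by simp [prcol]) fun r _ hr hmem => ?_
    obtain ⟨t, -, rfl⟩ := mem_image.1 hmem
    exact hr.not_ge (hmono (Nat.zero_le t))
  | succ s ih =>
    specialize ih (by omega)
    rcases (lfun_le n i a c s).lt_or_eq with h | h
    · have hi : i ≤ lfun n i a c s := (le_qmc hin a c).trans (hmono (Nat.zero_le s))
      have hi' : i ≤ lfun n i a c s + 1 := by omega
      have hblock : ∑ r ∈ Icc (lfun n i a c s + 1) (lfun n i a c (s + 1)), prcol n i a c r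
          = ∑ r ∈ Icc (lfun n i a c s + 1) (lfun n i a c (s + 1)), a r := by
        refine sum_prcol_block hi1 hi' h ?_ fun r hr hr' hmem => ?_
        · rw [prcol, if_neg (by omega), if_pos]
          exact mem_image.2 ⟨s, by simp; omega, by simp⟩
        · obtain ⟨t, -, rfl⟩ := mem_image.1 hmem
          rcases Nat.lt_or_ge s t with hst | hst
          · exact hr'.not_ge (hmono hst)
          · have := hmono hst
            omega
      have hle := (lfun_lt_succ h).le
      rw [← sum_Icc_add_sum_Icc_succ hi' hle, ← sum_Icc_add_sum_Icc_succ hi' hle, ih, hblock]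
    · rw [h] at ih
      rwa [lfun_succ_of_eq h]

/-- One step of the promotion algorithm outputs a column with the same sum as its input `a`. -/
theorem sum_prcol {n i : ℕ} (hi1 : 1 ≤ i) (hin : i ≤ n) (a c : Col) :
    ∑ r ∈ Icc i n, prcol n i a c r = ∑ r ∈ Icc i n, a r := by
  simpa only [lfun_self] using sum_prcol_lfun hi1 hin a c n le_rfl

theorem sum_prColJ {n i : ℕ} (hi1 : 1 ≤ i) (hin : i ≤ n) (A : Arr) (j : ℕ) :
    ∑ r ∈ Icc i n, prColJ n i A j r = ∑ r ∈ Icc i n, A (j - 1) r :=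
  sum_prcol hi1 hin _ _

theorem prMap_of_two_le {n i m : ℕ} {A : Arr} {p r : ℕ} (hp : 2 ≤ p) (hpi : p ≤ i)
    (hr : r ∈ Icc i n) : prMap n i m A p r = prColJ n i A p r := by
  rw [mem_Icc] at hr
  rw [prMap, if_pos (by omega), if_neg (by omega)]

theorem prMap_one_left {n i m : ℕ} {A : Arr} (hi : 1 ≤ i) (hin : i ≤ n) :
    prMap n i m A 1 i
      = (m : ℤ) - (∑ j ∈ Icc i n, A i j) - ∑ j ∈ Icc 2 i, prColJ n i A j i := by
  rw [prMap, if_pos (by omega), if_pos rfl, if_pos rfl]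

theorem prMap_one_of_lt {n i m : ℕ} {A : Arr} {r : ℕ} (hi : 1 ≤ i) (hir : i < r) (hrn : r ≤ n) :
    prMap n i m A 1 r
      = (∑ j ∈ Icc 1 i, A j (r - 1)) - ∑ j ∈ Icc 2 i, prColJ n i A j r := by
  rw [prMap, if_pos (by omega), if_pos rfl, if_neg (by omega)]

/-- The row sums of `pr(A)`, split at the first column. -/
theorem sum_prMap_row {n i m : ℕ} {A : Arr} {r : ℕ} (hi : 1 ≤ i) (hr : r ∈ Icc i n) :
    ∑ p ∈ Icc 1 i, prMap n i m A p r
      = prMap n i m A 1 r + ∑ p ∈ Icc 2 i, prColJ n i A p r := by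
  rw [← sum_Icc_add_sum_Icc_succ (Nat.le_succ 1) hi, Icc_self, sum_singleton]
  refine congrArg _ (sum_congr rfl fun p hp => ?_)
  rw [mem_Icc] at hp
  exact prMap_of_two_le hp.1 hp.2 hr

/-- The sum of the first column of `pr(A)`. -/
theorem sum_prMap_one {n i m : ℕ} {A : Arr} (hi : 1 ≤ i) (hin : i ≤ n) :
    ∑ r ∈ Icc i n, prMap n i m A 1 r = (m : ℤ) - ∑ p ∈ Icc 1 i, A p n := by
  have hrest : ∑ r ∈ Icc (i + 1) n, prMap n i m A 1 r
      = ∑ j ∈ Icc 1 i, ∑ r ∈ Icc i (n - 1), A j r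
        - ∑ r ∈ Icc (i + 1) n, ∑ j ∈ Icc 2 i, prColJ n i A j r := by
    rw [sum_comm, ← sum_Icc_succ_sub_one hi hin (fun r => ∑ j ∈ Icc 1 i, A j r),
      ← sum_sub_distrib]
    refine sum_congr rfl fun r hr => ?_
    rw [mem_Icc] at hr
    exact prMap_one_of_lt hi hr.1 hr.2
  have hcols : ∑ j ∈ Icc 2 i, prColJ n i A j i
      + ∑ r ∈ Icc (i + 1) n, ∑ j ∈ Icc 2 i, prColJ n i A j r
      = ∑ j ∈ Icc 1 (i - 1), ∑ r ∈ Icc i n, A j r := by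
    have hsplit := sum_Icc_add_sum_Icc_succ (Nat.le_succ i) hin
      (fun r => ∑ j ∈ Icc 2 i, prColJ n i A j r)
    rw [Icc_self, sum_singleton] at hsplit
    rw [hsplit, sum_comm, ← sum_Icc_succ_sub_one le_rfl hi]
    exact sum_congr rfl fun j _ => sum_prColJ hi hin A j
  have hlast : ∑ j ∈ Icc 1 i, ∑ r ∈ Icc i n, A j r
      = ∑ j ∈ Icc 1 i, ∑ r ∈ Icc i (n - 1), A j r + ∑ j ∈ Icc 1 i, A j n := by
    rw [← sum_add_distrib]
    refine sum_congr rfl fun j _ => ?_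
    rw [← sum_Icc_add_sum_Icc_succ (mid := n - 1) (by omega) (Nat.sub_le n 1),
      Nat.sub_add_cancel (hi.trans hin), Icc_self, sum_singleton]
  have hlast' : ∑ j ∈ Icc 1 i, ∑ r ∈ Icc i n, A j r
      = ∑ j ∈ Icc 1 (i - 1), ∑ r ∈ Icc i n, A j r + ∑ r ∈ Icc i n, A i r := by
    rw [← sum_Icc_add_sum_Icc_succ (mid := i - 1) (by omega) (Nat.sub_le i 1),
      Nat.sub_add_cancel hi, Icc_self, sum_singleton]
  rw [← sum_Icc_add_sum_Icc_succ (Nat.le_succ i) hin, Icc_self, sum_singleton, hrest,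
    prMap_one_left hi hin]
  linarith

/-- The promotion map cyclically shifts the content:
the content of `pr(A)` is `(r_{n+1}, r_1, …, r_n)`. -/
theorem stmt18 (n i m : ℕ) (hi : 2 ≤ i) (hin : i ≤ n) (A : Arr) (hA : InB n i m A) :
    cont n i m (prMap n i m A) 1 = cont n i m A (n + 1) ∧
    ∀ k ∈ Finset.Icc 2 (n + 1),
      cont n i m (prMap n i m A) k = cont n i m A (k - 1) := by
  have hi1 : 1 ≤ i := by omega
  refine ⟨?_, fun k hk => ?_⟩
  · rw [cont, cont, if_pos hi1, if_neg (by omega), sum_prMap_one hi1 hin, Nat.add_sub_cancel]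
    ring
  · rw [mem_Icc] at hk
    rcases le_or_gt k i with hki | hki
    · rw [cont, cont, if_pos hki, if_pos (by omega), ← sum_prColJ hi1 hin A k]
      exact congrArg _ (sum_congr rfl fun r hr => prMap_of_two_le hk.1 hki hr)
    · have hr : k - 1 ∈ Icc i n := mem_Icc.2 (by omega)
      rw [cont, if_neg (by omega), sum_prMap_row hi1 hr]
      rcases (Nat.le_sub_one_of_lt hki).eq_or_lt with h | h
      · rw [cont, ← h, if_pos le_rfl, prMap_one_left hi1 hin]
        ring
      · rw [cont, if_neg (by omega), prMap_one_of_lt hi1 h (by omega)]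
        ring

end KR
end

section
/- The promotion map pr on B^{m,i} satisfies pr^{n+1} = id; equivalently, the inverse of pr is pr^{n}. -/
open Finset

namespace KR

/-! ### Birational rowmotion on a product of two chains -/

/-- The sum of the weights of all lattice paths from `(r, q)` to `(r + k, q + l)`. -/
def pathSum (A : ℕ → ℕ → ℝ) : ℕ → ℕ → ℕ → ℕ → ℝ
  | 0, 0, r, q => A r q
  | k + 1, 0, r, q => A r q * pathSum A k 0 (r + 1) q
  | 0, l + 1, r, q => A r q * pathSum A 0 l r (q + 1)
  | k + 1, l + 1, r, q =>
      A r q * (pathSum A k (l + 1) (r + 1) q + pathSum A (k + 1) l r (q + 1))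

theorem pathSum_last_row (A : ℕ → ℕ → ℝ) (k r q : ℕ) :
    pathSum A (k + 1) 0 r q = A (r + k + 1) q * pathSum A k 0 r q := by
  induction k generalizing r with
  | zero => simp [pathSum]; ring
  | succ k ih =>
    rw [pathSum, ih, pathSum, show r + 1 + k + 1 = r + (k + 1) + 1 by ring]; ring

theorem pathSum_last_col (A : ℕ → ℕ → ℝ) (l r q : ℕ) :
    pathSum A 0 (l + 1) r q = A r (q + l + 1) * pathSum A 0 l r q := by
  induction l generalizing q with
  | zero => simp [pathSum]; ring
  | succ l ih =>
    rw [pathSum, ih, pathSum, show q + 1 + l + 1 = q + (l + 1) + 1 by ring]; ring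

theorem pathSum_zero_succ (A : ℕ → ℕ → ℝ) (l r q : ℕ) :
    pathSum A 0 (l + 1) r q = A r q * pathSum A 0 l r (q + 1) := by
  rw [pathSum]

theorem pathSum_succ_succ (A : ℕ → ℕ → ℝ) (k l r q : ℕ) :
    pathSum A (k + 1) (l + 1) r q =
      A r q * (pathSum A k (l + 1) (r + 1) q + pathSum A (k + 1) l r (q + 1)) := by
  rw [pathSum]

theorem pathSum_last (A : ℕ → ℕ → ℝ) (k l r q : ℕ) :
    pathSum A (k + 1) (l + 1) r q =
      A (r + k + 1) (q + l + 1) * (pathSum A k (l + 1) r q + pathSum A (k + 1) l r q) := by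
  induction k generalizing l r q with
  | zero =>
    induction l generalizing q with
    | zero => simp only [pathSum, Nat.add_zero, zero_add]; ring
    | succ l ih =>
      rw [pathSum_succ_succ A 0 (l + 1) r q, ih, pathSum_last_col A (l + 1),
        pathSum_zero_succ A (l + 1) r q, pathSum_succ_succ A 0 l r q,
        show q + 1 + l + 1 = q + (l + 1) + 1 by ring]
      simp only [Nat.add_zero]; ring
  | succ k ihk =>
    induction l generalizing q with
    | zero =>
      rw [pathSum_succ_succ A (k + 1) 0 r q, ihk, pathSum_last_row A (k + 1),
        pathSum_succ_succ A k 0 r q, pathSum.eq_2 A r q (k + 1),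
        show r + 1 + k + 1 = r + (k + 1) + 1 by ring]
      simp only [Nat.add_zero]; ring
    | succ l ihl =>
      rw [pathSum_succ_succ A (k + 1) (l + 1) r q, ihk, ihl (q + 1),
        pathSum_succ_succ A k (l + 1) r q, pathSum_succ_succ A (k + 1) l r q,
        show r + 1 + k + 1 = r + (k + 1) + 1 by ring,
        show q + 1 + l + 1 = q + (l + 1) + 1 by ring]
      ring

theorem pathSum_pos {A : ℕ → ℕ → ℝ} (hA : ∀ p q, 0 < A p q) (k l r q : ℕ) :
    0 < pathSum A k l r q := by
  induction k, l, r, q using pathSum.induct with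
  | case1 => rw [pathSum]; exact hA _ _
  | case2 r q k ih => rw [pathSum]; exact mul_pos (hA _ _) ih
  | case3 r q l ih => rw [pathSum]; exact mul_pos (hA _ _) ih
  | case4 r q k l ih ih' => rw [pathSum]; exact mul_pos (hA _ _) (add_pos ih ih')

/-- The sum of the weights of all lattice paths from `(0, 0)`. -/
def orderLabel (A : ℕ → ℕ → ℝ) (p q : ℕ) : ℝ := pathSum A p q 0 0

/-- The sum of the labels of the lower covers, with the label `1` below the bottom. -/
def lowerSum (x : ℕ → ℕ → ℝ) : ℕ → ℕ → ℝ
  | 0, 0 => 1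
  | p + 1, 0 => x p 0
  | 0, q + 1 => x 0 q
  | p + 1, q + 1 => x p (q + 1) + x (p + 1) q

/-- The sum of the inverse labels of the upper covers in `[0, a] × [0, b]`, with the label `M`
above the top. -/
noncomputable def upperInvSum (a b : ℕ) (M : ℝ) (x : ℕ → ℕ → ℝ) (p q : ℕ) : ℝ :=
  if p < a then
    if q < b then (x (p + 1) q)⁻¹ + (x p (q + 1))⁻¹ else (x (p + 1) q)⁻¹
  else if q < b then (x p (q + 1))⁻¹ else M⁻¹

/-- Birational rowmotion in antichain coordinates. -/
noncomputable def rowmotion (a b : ℕ) (M : ℝ) (A : ℕ → ℕ → ℝ) : ℕ → ℕ → ℝ := fun p q =>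
  (orderLabel A p q * upperInvSum a b M (orderLabel A) p q)⁻¹

theorem orderLabel_eq (A : ℕ → ℕ → ℝ) (p q : ℕ) :
    orderLabel A p q = A p q * lowerSum (orderLabel A) p q := by
  unfold orderLabel
  rcases p with _ | p <;> rcases q with _ | q
  · simp [pathSum, lowerSum]
  · rw [pathSum_last_col]; simp [lowerSum]
  · rw [pathSum_last_row]; simp [lowerSum]
  · rw [pathSum_last]; simp [lowerSum]

theorem orderLabel_pos {A : ℕ → ℕ → ℝ} (hA : ∀ p q, 0 < A p q) (p q : ℕ) :
    0 < orderLabel A p q := pathSum_pos hA _ _ _ _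

theorem upperInvSum_pos {M : ℝ} (hM : 0 < M) {x : ℕ → ℕ → ℝ} (hx : ∀ p q, 0 < x p q)
    (a b p q : ℕ) : 0 < upperInvSum a b M x p q := by
  have := hx (p + 1) q
  have := hx p (q + 1)
  unfold upperInvSum
  split_ifs <;> positivity

theorem rowmotion_pos {M : ℝ} (hM : 0 < M) {A : ℕ → ℕ → ℝ} (hA : ∀ p q, 0 < A p q)
    (a b p q : ℕ) : 0 < rowmotion a b M A p q :=
  inv_pos.2 (mul_pos (orderLabel_pos hA _ _) (upperInvSum_pos hM (orderLabel_pos hA) _ _ _ _))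

/-- The labels `x` are dual to the path sums to the top for the rowmotion image. -/
theorem pathSum_rowmotion {a b : ℕ} {M : ℝ} (hM : 0 < M) {A : ℕ → ℕ → ℝ}
    (hA : ∀ p q, 0 < A p q) (k l p q : ℕ) (hp : p + k = a) (hq : q + l = b) :
    pathSum (rowmotion a b M A) k l p q * orderLabel A p q = M := by
  have hx := orderLabel_pos hA
  induction h : k + l generalizing k l p q with
  | zero =>
    obtain ⟨rfl, rfl⟩ : k = 0 ∧ l = 0 := by omega
    have := hx p q
    simp only [pathSum, rowmotion, upperInvSum]
    rw [if_neg (by omega), if_neg (by omega)]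
    field_simp
  | succ N ih =>
    have h0 := (hx p q).ne'
    rcases k with _ | k <;> rcases l with _ | l
    · omega
    · have h1 := ih 0 l p (q + 1) (by omega) (by omega) (by omega)
      have h2 := (hx p (q + 1)).ne'
      simp only [pathSum]
      rw [eq_div_of_mul_eq h2 h1]
      simp only [rowmotion, upperInvSum]
      rw [if_neg (by omega), if_pos (by omega)]
      field_simp
    · have h1 := ih k 0 (p + 1) q (by omega) (by omega) (by omega)
      have h2 := (hx (p + 1) q).ne'
      simp only [pathSum]
      rw [eq_div_of_mul_eq h2 h1]
      simp only [rowmotion, upperInvSum]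
      rw [if_pos (by omega), if_neg (by omega)]
      field_simp
    · have h1 := ih (k + 1) l p (q + 1) (by omega) (by omega) (by omega)
      have h2 := hx p (q + 1)
      have h3 := ih k (l + 1) (p + 1) q (by omega) (by omega) (by omega)
      have h4 := hx (p + 1) q
      simp only [pathSum]
      rw [eq_div_of_mul_eq h2.ne' h1, eq_div_of_mul_eq h4.ne' h3]
      simp only [rowmotion, upperInvSum]
      rw [if_pos (by omega), if_pos (by omega)]
      field_simp

/-- Interpolates between path sums of a labelling and of its rowmotion image: paths from `(r, q)`
to `(r + k + 1, q + l)` crossing column `q + l` by a ratio of labels. -/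
noncomputable def mixedSum (B x : ℕ → ℕ → ℝ) : ℕ → ℕ → ℕ → ℕ → ℝ
  | k, 0, r, q => x (r + k + 1) q / x r q
  | 0, l + 1, r, q => B r q * mixedSum B x 0 l r (q + 1)
  | k + 1, l + 1, r, q =>
      B r q * (mixedSum B x k (l + 1) (r + 1) q + mixedSum B x (k + 1) l r (q + 1))

theorem mixedSum_zero_succ (B x : ℕ → ℕ → ℝ) (l r q : ℕ) :
    mixedSum B x 0 (l + 1) r q = B r q * mixedSum B x 0 l r (q + 1) := by
  rw [mixedSum]

theorem mixedSum_succ_succ (B x : ℕ → ℕ → ℝ) (k l r q : ℕ) :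
    mixedSum B x (k + 1) (l + 1) r q =
      B r q * (mixedSum B x k (l + 1) (r + 1) q + mixedSum B x (k + 1) l r (q + 1)) := by
  rw [mixedSum]

theorem mixedSum_eq_rowmotion {a b : ℕ} {M : ℝ} {A : ℕ → ℕ → ℝ}
    (hA : ∀ p q, 0 < A p q) (k l r q : ℕ) (hr : r + k + 1 ≤ a) (hq : q + l = b) :
    mixedSum (rowmotion a b M A) (orderLabel A) k l r q =
      pathSum (rowmotion a b M A) k l r q := by
  have hx := orderLabel_pos hA
  have key : ∀ r, r < a → rowmotion a b M A r b = orderLabel A (r + 1) b / orderLabel A r b := by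
    intro r hr
    have := hx r b
    have := hx (r + 1) b
    simp only [rowmotion, upperInvSum]
    rw [if_pos hr, if_neg (by omega)]
    field_simp
  induction l generalizing k r q with
  | zero =>
    obtain rfl : q = b := by omega
    induction k generalizing r with
    | zero => simp [mixedSum, pathSum, key r (by omega)]
    | succ k ih =>
      rw [pathSum, ← ih (r + 1) (by omega), key r (by omega)]
      have := hx r q
      have := hx (r + 1) q
      simp only [mixedSum]
      rw [show r + 1 + k + 1 = r + (k + 1) + 1 by ring]
      field_simp
  | succ l ih =>
    induction k generalizing r with
    | zero => simp only [mixedSum, pathSum]; rw [ih 0 r (q + 1) (by omega) (by omega)]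
    | succ k ihk =>
      simp only [mixedSum, pathSum]
      rw [ih (k + 1) r (q + 1) (by omega) (by omega), ihk (r + 1) (by omega)]

section
variable {a b : ℕ} {M : ℝ} {A : ℕ → ℕ → ℝ}

theorem rowmotion_interior (hA : ∀ p q, 0 < A p q) {p q : ℕ} (hp : p < a) (hq : q < b) :
    rowmotion a b M A p q = orderLabel A (p + 1) q * orderLabel A p (q + 1) /
      (orderLabel A p q * (orderLabel A p (q + 1) + orderLabel A (p + 1) q)) := by
  have := orderLabel_pos hA p q
  have := orderLabel_pos hA (p + 1) q
  have := orderLabel_pos hA p (q + 1)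
  simp only [rowmotion, upperInvSum]
  rw [if_pos hp, if_pos hq]
  field_simp

theorem label_interior (hA : ∀ p q, 0 < A p q) (p q : ℕ) :
    A (p + 1) (q + 1) = orderLabel A (p + 1) (q + 1) /
      (orderLabel A p (q + 1) + orderLabel A (p + 1) q) := by
  have := orderLabel_pos hA (p + 1) q
  have := orderLabel_pos hA p (q + 1)
  rw [orderLabel_eq A (p + 1) (q + 1), lowerSum]
  field_simp

theorem mixedSum_last_zero (hA : ∀ p q, 0 < A p q) (l r q : ℕ) (hr : r < a) (hq : q + l < b) :
    mixedSum (rowmotion a b M A) (orderLabel A) 0 (l + 1) r q =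
      A (r + 1) (q + l + 1) * mixedSum (rowmotion a b M A) (orderLabel A) 0 l r q := by
  induction l generalizing q with
  | zero =>
    have := orderLabel_pos hA r q
    have := orderLabel_pos hA (r + 1) q
    have := orderLabel_pos hA r (q + 1)
    simp only [mixedSum, Nat.add_zero]
    rw [rowmotion_interior hA hr (by omega), label_interior hA]
    field_simp
  | succ l ih =>
    rw [mixedSum, ih (q + 1) (by omega), mixedSum, show q + 1 + l + 1 = q + (l + 1) + 1 by ring]
    ring

theorem mixedSum_last (hA : ∀ p q, 0 < A p q) (k l r q : ℕ) (hr : r + k + 1 < a)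
    (hq : q + l < b) :
    mixedSum (rowmotion a b M A) (orderLabel A) (k + 1) (l + 1) r q =
      A (r + k + 2) (q + l + 1) * (mixedSum (rowmotion a b M A) (orderLabel A) k (l + 1) r q +
        mixedSum (rowmotion a b M A) (orderLabel A) (k + 1) l r q) := by
  induction l generalizing k r q with
  | zero =>
    induction k generalizing r with
    | zero =>
      have := orderLabel_pos hA r q
      have := orderLabel_pos hA (r + 1) q
      have := orderLabel_pos hA r (q + 1)
      have := orderLabel_pos hA (r + 2) q
      have := orderLabel_pos hA (r + 1) (q + 1)
      simp only [mixedSum, Nat.add_zero, zero_add]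
      rw [rowmotion_interior hA (p := r) (by omega) (by omega),
        rowmotion_interior hA (p := r + 1) (by omega) (by omega), label_interior hA]
      simp only [add_assoc, Nat.reduceAdd]
      field_simp
      ring
    | succ k ih =>
      have := orderLabel_pos hA r q
      have := orderLabel_pos hA (r + 1) q
      have := orderLabel_pos hA r (q + 1)
      have h1 := orderLabel_pos hA (r + k + 2) (q + 1)
      have h2 := orderLabel_pos hA (r + k + 3) q
      rw [mixedSum_succ_succ _ _ (k + 1), ih (r + 1) (by omega)]
      simp only [mixedSum, Nat.add_zero]
      rw [rowmotion_interior hA (p := r) (by omega) (by omega),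
        show r + 1 + k + 2 = r + k + 2 + 1 by ring, show r + (k + 1) + 2 = r + k + 2 + 1 by ring,
        label_interior hA]
      simp only [show r + 1 + (k + 1) + 1 = r + k + 3 by ring,
        show r + (k + 1 + 1) + 1 = r + k + 3 by ring, show r + (k + 1) + 1 = r + k + 2 by ring,
        show r + k + 2 + 1 = r + k + 3 by ring]
      field_simp
      ring
  | succ l ihl =>
    induction k generalizing r with
    | zero =>
      rw [mixedSum_succ_succ _ _ 0 (l + 1) r q, ihl 0 r (q + 1) (by omega) (by omega),
        mixedSum_last_zero hA (l + 1) (r + 1) q (by omega) (by omega),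
        mixedSum_zero_succ _ _ (l + 1) r q, mixedSum_succ_succ _ _ 0 l r q]
      simp only [show q + 1 + l + 1 = q + (l + 1) + 1 by ring, Nat.add_zero,
        show r + 1 + 1 = r + 2 by ring]
      ring
    | succ k ihk =>
      rw [mixedSum_succ_succ _ _ (k + 1) (l + 1) r q, ihl (k + 1) r (q + 1) (by omega) (by omega),
        ihk (r + 1) (by omega), mixedSum_succ_succ _ _ k (l + 1) r q,
        mixedSum_succ_succ _ _ (k + 1) l r q]
      simp only [show q + 1 + l + 1 = q + (l + 1) + 1 by ring,
        show r + 1 + k + 2 = r + (k + 1) + 2 by ring]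
      ring

theorem mixedSum_eq_pathSum (hA : ∀ p q, 0 < A p q) (k l r : ℕ) (hr : r + k + 1 ≤ a)
    (hl : l ≤ b) :
    mixedSum (rowmotion a b M A) (orderLabel A) k l r 0 = pathSum A k l (r + 1) 0 := by
  have hcol : ∀ r, A (r + 1) 0 = orderLabel A (r + 1) 0 / orderLabel A r 0 := by
    intro r
    have := orderLabel_pos hA r 0
    rw [orderLabel_eq A (r + 1) 0, lowerSum]
    field_simp
  induction l generalizing k r with
  | zero =>
    induction k generalizing r with
    | zero => simp [mixedSum, pathSum, hcol r]
    | succ k ih =>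
      rw [pathSum, ← ih (r + 1) (by omega), hcol r]
      have := orderLabel_pos hA r 0
      have := orderLabel_pos hA (r + 1) 0
      simp only [mixedSum]
      rw [show r + 1 + k + 1 = r + (k + 1) + 1 by ring]
      field_simp
  | succ l ihl =>
    induction k with
    | zero =>
      rw [mixedSum_last_zero hA l r 0 (by omega) (by omega), pathSum_last_col,
        ihl 0 r (by omega) (by omega)]
    | succ k ihk =>
      rw [mixedSum_last hA k l r 0 (by omega) (by omega), pathSum_last,
        ihl (k + 1) r (by omega) (by omega), ihk (by omega)]
      simp only [show r + 1 + k + 1 = r + k + 2 by ring]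

/-- Chain shifting: rowmotion shifts path sums across the rectangle by one row. -/
theorem pathSum_shift (hA : ∀ p q, 0 < A p q) (k r : ℕ) (hr : r + k + 1 ≤ a) :
    pathSum (rowmotion a b M A) k b r 0 = pathSum A k b (r + 1) 0 := by
  rw [← mixedSum_eq_rowmotion hA k b r 0 hr (by omega), mixedSum_eq_pathSum hA k b r hr le_rfl]

theorem rowmotion_iterate_pos (hM : 0 < M) (hA : ∀ p q, 0 < A p q) (t p q : ℕ) :
    0 < (rowmotion a b M)^[t] A p q := by
  induction t generalizing p q with
  | zero => exact hA p q
  | succ t ih => rw [Function.iterate_succ_apply']; exact rowmotion_pos hM ih a b p q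

theorem pathSum_iterate_shift (hM : 0 < M) (hA : ∀ p q, 0 < A p q) (t k r : ℕ)
    (hr : r + k ≤ a) :
    pathSum ((rowmotion a b M)^[t + r] A) k b 0 0 = pathSum ((rowmotion a b M)^[t] A) k b r 0 := by
  induction r generalizing t with
  | zero => rfl
  | succ r ih =>
    rw [show t + (r + 1) = t + 1 + r by ring, ih (t + 1) (by omega),
      Function.iterate_succ_apply', pathSum_shift (rowmotion_iterate_pos hM hA t) k r (by omega)]

theorem orderLabel_reciprocity_edge (hM : 0 < M) (hA : ∀ p q, 0 < A p q) (t p : ℕ) (hp : p ≤ a) :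
    orderLabel ((rowmotion a b M)^[t + p + 1] A) (a - p) b *
      orderLabel ((rowmotion a b M)^[t] A) p 0 = M := by
  rw [orderLabel, show t + p + 1 = t + 1 + p by ring,
    pathSum_iterate_shift hM hA (t + 1) (a - p) p (by omega), Function.iterate_succ_apply']
  exact pathSum_rowmotion hM (rowmotion_iterate_pos hM hA t) _ _ _ _ (by omega) (by omega)

theorem orderLabel_recurrence (hM : 0 < M) (hA : ∀ p q, 0 < A p q) (t p q : ℕ) :
    orderLabel ((rowmotion a b M)^[t + 1] A) p q * (orderLabel ((rowmotion a b M)^[t] A) p q *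
      upperInvSum a b M (orderLabel ((rowmotion a b M)^[t] A)) p q) =
      lowerSum (orderLabel ((rowmotion a b M)^[t + 1] A)) p q := by
  have h1 := orderLabel_pos (rowmotion_iterate_pos (a := a) (b := b) hM hA t) p q
  have h2 := upperInvSum_pos hM (orderLabel_pos (rowmotion_iterate_pos (a := a) (b := b) hM hA t))
    a b p q
  rw [orderLabel_eq]
  nth_rewrite 1 [Function.iterate_succ_apply']
  rw [rowmotion]
  field_simp

/-- Reciprocity for birational rowmotion on a rectangle. -/
theorem orderLabel_reciprocity (hM : 0 < M) (hA : ∀ p q, 0 < A p q) (t p q : ℕ) (hp : p ≤ a)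
    (hq : q ≤ b) :
    orderLabel ((rowmotion a b M)^[t + p + q + 1] A) (a - p) (b - q) *
      orderLabel ((rowmotion a b M)^[t] A) p q = M := by
  set x : ℕ → ℕ → ℕ → ℝ := fun t => orderLabel ((rowmotion a b M)^[t] A) with hx
  have hpos : ∀ t p q, 0 < x t p q := fun t =>
    orderLabel_pos (rowmotion_iterate_pos hM hA t)
  have hrec : ∀ t p q, x (t + 1) p q * (x t p q * upperInvSum a b M (x t) p q) =
      lowerSum (x (t + 1)) p q := fun t p q => orderLabel_recurrence hM hA t p q
  change x (t + p + q + 1) (a - p) (b - q) * x t p q = M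
  induction q using Nat.strong_induction_on generalizing t p with
  | _ q ih =>
  rcases q with _ | q
  · exact orderLabel_reciprocity_edge hM hA t p hp
  have hupper : upperInvSum a b M (x (t + p + q + 1)) (a - p) (b - q) =
      lowerSum (x (t + 1)) p q / M := by
    unfold upperInvSum
    have inv_eq : ∀ {y z : ℝ}, 0 < y → y * z = M → y⁻¹ = z / M := by
      intro y z hy h
      rw [← h]
      have : z ≠ 0 := by rintro rfl; simp at h; exact hM.ne h
      field_simp
    have hcol : ∀ p', p = p' + 1 → (x (t + p + q + 1) (a - p + 1) (b - q))⁻¹ =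
        x (t + 1) p' q / M := by
      rintro p' rfl
      refine inv_eq (hpos _ _ _) ?_
      have := ih q (by omega) (t + 1) p' (by omega) (by omega)
      rwa [show t + 1 + p' + q + 1 = t + (p' + 1) + q + 1 by ring,
        show a - p' = a - (p' + 1) + 1 by omega] at this
    have hrow : ∀ q', q = q' + 1 → (x (t + p + q + 1) (a - p) (b - q + 1))⁻¹ =
        x (t + 1) p q' / M := by
      rintro q' rfl
      refine inv_eq (hpos _ _ _) ?_
      have := ih q' (by omega) (t + 1) p hp (by omega)
      rwa [show t + 1 + p + q' + 1 = t + p + (q' + 1) + 1 by ring,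
        show b - q' = b - (q' + 1) + 1 by omega] at this
    rcases p with _ | p <;> rcases q with _ | q
    · rw [if_neg (by omega), if_neg (by omega), lowerSum, one_div]
    · rw [if_neg (by omega), if_pos (by omega), lowerSum, hrow q rfl]
    · rw [if_pos (by omega), if_neg (by omega), lowerSum, hcol p rfl]
    · rw [if_pos (by omega), if_pos (by omega), lowerSum, hcol p rfl, hrow q rfl, add_div]
  have e1 := hrec (t + p + q + 1) (a - p) (b - q)
  rw [hupper] at e1
  have r0 := ih q (by omega) t p hp (by omega)
  have r1 := ih q (by omega) (t + 1) p hp (by omega)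
  rw [show t + 1 + p + q + 1 = t + p + q + 1 + 1 by ring] at r1
  rw [← hrec t p q, eq_div_of_mul_eq (hpos _ _ _).ne' r0,
    eq_div_of_mul_eq (hpos _ _ _).ne' r1] at e1
  have h0 := hpos t p q
  have h1 := hpos (t + 1) p q
  have e2 : M * upperInvSum a b M (x t) p q =
      lowerSum (x (t + p + q + 1 + 1)) (a - p) (b - q) := by
    rw [← e1]; field_simp
  obtain ⟨b', hb'⟩ : ∃ b', b - q = b' + 1 := ⟨b - q - 1, by omega⟩
  have hb'' : b - (q + 1) = b' := by omega
  have h2 := hpos t p (q + 1)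
  rw [hb'', show t + p + (q + 1) + 1 = t + p + q + 1 + 1 by ring]
  rcases hp.lt_or_eq with hp' | rfl
  · obtain ⟨a', ha'⟩ : ∃ a', a - p = a' + 1 := ⟨a - p - 1, by omega⟩
    have r2 := ih q (by omega) t (p + 1) (by omega) (by omega)
    rw [show a - (p + 1) = a' by omega, hb',
      show t + (p + 1) + q + 1 = t + p + q + 1 + 1 by ring] at r2
    rw [hb', ha', lowerSum, eq_div_of_mul_eq (hpos _ _ _).ne' r2, upperInvSum, if_pos hp',
      if_pos (by omega)] at e2
    have h3 := hpos t (p + 1) q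
    rw [ha']
    have e3 : x (t + p + q + 1 + 1) (a' + 1) b' = M * (x t p (q + 1))⁻¹ := by
      rw [div_eq_mul_inv] at e2; linarith
    rw [e3]; field_simp
  · rw [hb', Nat.sub_self, lowerSum, upperInvSum, if_neg (by omega), if_pos (by omega)] at e2
    rw [Nat.sub_self, ← e2]; field_simp

/-- Birational rowmotion on a rectangle with sides `a + 1` and `b + 1` has order `a + b + 2`. -/
theorem orderLabel_periodic (hM : 0 < M) (hA : ∀ p q, 0 < A p q) (t p q : ℕ) (hp : p ≤ a)
    (hq : q ≤ b) :
    orderLabel ((rowmotion a b M)^[t + (a + b + 2)] A) p q =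
      orderLabel ((rowmotion a b M)^[t] A) p q := by
  have h1 := orderLabel_reciprocity (b := b) hM hA t p q hp hq
  have h2 := orderLabel_reciprocity (a := a) (b := b) hM hA (t + p + q + 1) (a - p) (b - q)
    (by omega) (by omega)
  rw [Nat.sub_sub_self hp, Nat.sub_sub_self hq,
    show t + p + q + 1 + (a - p) + (b - q) + 1 = t + (a + b + 2) by omega, mul_comm] at h2
  exact mul_left_cancel₀
    (orderLabel_pos (rowmotion_iterate_pos hM hA _) _ _).ne' (h2.trans h1.symm)

theorem rowmotion_periodic (hM : 0 < M) (hA : ∀ p q, 0 < A p q) (p q : ℕ) (hp : p ≤ a)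
    (hq : q ≤ b) : (rowmotion a b M)^[a + b + 2] A p q = A p q := by
  have hx : ∀ p q, p ≤ a → q ≤ b →
      orderLabel ((rowmotion a b M)^[a + b + 2] A) p q = orderLabel A p q := by
    intro p q hp hq
    simpa using orderLabel_periodic (a := a) (b := b) hM hA 0 p q hp hq
  have hl : lowerSum (orderLabel ((rowmotion a b M)^[a + b + 2] A)) p q =
      lowerSum (orderLabel A) p q := by
    rcases p with _ | p <;> rcases q with _ | q <;> simp only [lowerSum]
    · exact hx _ _ (by omega) (by omega)
    · exact hx _ _ (by omega) (by omega)
    · rw [hx _ _ (by omega) hq, hx _ _ hp (by omega)]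
  have h0 := hx p q hp hq
  have hpos := orderLabel_pos hA p q
  rw [orderLabel_eq, orderLabel_eq A, hl] at h0
  refine mul_right_cancel₀ ?_ h0
  intro h
  rw [orderLabel_eq, h, mul_zero] at hpos
  exact hpos.false

end

/-! ### Growth rates of positive functions -/

/-- The function `f` grows like `s ^ d` on `[1, ∞)` up to multiplicative constants. -/
def Growth (f : ℝ → ℝ) (d : ℤ) : Prop :=
  ∃ C : ℝ, 0 < C ∧ ∀ s : ℝ, 1 ≤ s → C⁻¹ * s ^ d ≤ f s ∧ f s ≤ C * s ^ d

theorem Growth.zpow (d : ℤ) : Growth (fun s => s ^ d) d :=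
  ⟨1, one_pos, fun s _ => by simp⟩

theorem Growth.mul {f g : ℝ → ℝ} {d e : ℤ} (hf : Growth f d) (hg : Growth g e) :
    Growth (fun s => f s * g s) (d + e) := by
  obtain ⟨C, hC, hf⟩ := hf
  obtain ⟨D, hD, hg⟩ := hg
  refine ⟨C * D, by positivity, fun s hs => ?_⟩
  have hs0 : 0 < s := by linarith
  obtain ⟨f1, f2⟩ := hf s hs
  obtain ⟨g1, g2⟩ := hg s hs
  have hd : 0 < s ^ d := by positivity
  have he : 0 < s ^ e := by positivity
  have f0 : 0 < f s := lt_of_lt_of_le (by positivity) f1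
  have g0 : 0 < g s := lt_of_lt_of_le (by positivity) g1
  rw [zpow_add₀ hs0.ne', mul_inv]
  constructor
  · calc C⁻¹ * D⁻¹ * (s ^ d * s ^ e) = (C⁻¹ * s ^ d) * (D⁻¹ * s ^ e) := by ring
      _ ≤ f s * g s := by gcongr
  · calc f s * g s ≤ (C * s ^ d) * (D * s ^ e) := by gcongr
      _ = C * D * (s ^ d * s ^ e) := by ring

theorem Growth.inv {f : ℝ → ℝ} {d : ℤ} (hf : Growth f d) : Growth (fun s => (f s)⁻¹) (-d) := by
  obtain ⟨C, hC, hf⟩ := hf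
  refine ⟨C, hC, fun s hs => ?_⟩
  have hs0 : 0 < s := by linarith
  obtain ⟨f1, f2⟩ := hf s hs
  have hd : 0 < s ^ d := by positivity
  have f0 : 0 < f s := lt_of_lt_of_le (by positivity) f1
  rw [zpow_neg, ← mul_inv]
  refine ⟨inv_anti₀ f0 f2, ?_⟩
  calc (f s)⁻¹ ≤ (C⁻¹ * s ^ d)⁻¹ := inv_anti₀ (by positivity) f1
    _ = C * (s ^ d)⁻¹ := by rw [mul_inv, inv_inv]

theorem Growth.add {f g : ℝ → ℝ} {d e : ℤ} (hf : Growth f d) (hg : Growth g e) :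
    Growth (fun s => f s + g s) (max d e) := by
  wlog h : d ≤ e generalizing f g d e
  · simpa only [add_comm, max_comm] using this hg hf (by omega)
  obtain ⟨C, hC, hf⟩ := hf
  obtain ⟨D, hD, hg⟩ := hg
  rw [max_eq_right h]
  refine ⟨C + D, by positivity, fun s hs => ?_⟩
  have hs0 : 0 < s := by linarith
  obtain ⟨f1, f2⟩ := hf s hs
  obtain ⟨g1, g2⟩ := hg s hs
  have hde : s ^ d ≤ s ^ e := zpow_le_zpow_right₀ hs h
  have hd : 0 < s ^ d := by positivity
  have f0 : 0 < f s := lt_of_lt_of_le (by positivity) f1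
  constructor
  · calc (C + D)⁻¹ * s ^ e ≤ D⁻¹ * s ^ e := by gcongr; linarith
      _ ≤ f s + g s := by linarith
  · calc f s + g s ≤ C * s ^ e + D * s ^ e := by
          have := mul_le_mul_of_nonneg_left hde hC.le
          linarith
      _ = (C + D) * s ^ e := by ring

theorem Growth.le {f g : ℝ → ℝ} {d e : ℤ} (hf : Growth f d) (hg : Growth g e)
    (h : ∀ s, 1 ≤ s → f s = g s) : d ≤ e := by
  obtain ⟨C, hC, hf⟩ := hf
  obtain ⟨D, hD, hg⟩ := hg
  by_contra! hlt
  have key : ∀ s : ℝ, 1 ≤ s → s ≤ C * D := by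
    intro s hs
    have hs0 : 0 < s := by linarith
    have h1 : C⁻¹ * s ^ d ≤ D * s ^ e := (hf s hs).1.trans ((h s hs).trans_le (hg s hs).2)
    have h2 : s ^ (e + 1) ≤ s ^ d := zpow_le_zpow_right₀ hs (by omega)
    rw [zpow_add_one₀ hs0.ne'] at h2
    have he : 0 < s ^ e := by positivity
    rw [inv_mul_le_iff₀ hC] at h1
    have h3 : s ^ e * s ≤ s ^ e * (C * D) := by linarith
    exact le_of_mul_le_mul_left h3 he
  have := key (C * D + 1) (by nlinarith [mul_pos hC hD])
  linarith

theorem Growth.unique {f g : ℝ → ℝ} {d e : ℤ} (hf : Growth f d) (hg : Growth g e)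
    (h : ∀ s, 1 ≤ s → f s = g s) : d = e :=
  le_antisymm (hf.le hg h) (hg.le hf fun s hs => (h s hs).symm)

/-! ### Piecewise-linear rowmotion -/

/-- The maximal weight of a lattice path from `(0, 0)`. -/
def maxPath (A : ℕ → ℕ → ℤ) : ℕ → ℕ → ℤ
  | 0, 0 => A 0 0
  | p + 1, 0 => A (p + 1) 0 + maxPath A p 0
  | 0, q + 1 => A 0 (q + 1) + maxPath A 0 q
  | p + 1, q + 1 => A (p + 1) (q + 1) + max (maxPath A p (q + 1)) (maxPath A (p + 1) q)

/-- Piecewise-linear rowmotion in antichain coordinates. -/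
def tropRowmotion (a b : ℕ) (m : ℤ) (A : ℕ → ℕ → ℤ) : ℕ → ℕ → ℤ := fun p q =>
  (if p < a then
    if q < b then min (maxPath A (p + 1) q) (maxPath A p (q + 1)) else maxPath A (p + 1) q
  else if q < b then maxPath A p (q + 1) else m) - maxPath A p q

theorem growth_orderLabel {F : ℝ → ℕ → ℕ → ℝ} {A : ℕ → ℕ → ℤ}
    (h : ∀ p q, Growth (fun s => F s p q) (A p q)) (p q : ℕ) :
    Growth (fun s => orderLabel (F s) p q) (maxPath A p q) := by
  induction p, q using maxPath.induct with
  | case1 =>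
    simp only [orderLabel_eq (F _) 0 0, lowerSum, mul_one, maxPath]
    exact h 0 0
  | case2 p ih =>
    simp only [orderLabel_eq (F _) (p + 1) 0, lowerSum, maxPath]
    exact (h _ _).mul ih
  | case3 q ih =>
    simp only [orderLabel_eq (F _) 0 (q + 1), lowerSum, maxPath]
    exact (h _ _).mul ih
  | case4 p q ih1 ih2 =>
    simp only [orderLabel_eq (F _) (p + 1) (q + 1), lowerSum, maxPath]
    exact (h _ _).mul (ih1.add ih2)

theorem growth_rowmotion (a b : ℕ) (m : ℤ) {F : ℝ → ℕ → ℕ → ℝ} {A : ℕ → ℕ → ℤ}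
    (h : ∀ p q, Growth (fun s => F s p q) (A p q)) (p q : ℕ) :
    Growth (fun s => rowmotion a b (s ^ m) (F s) p q) (tropRowmotion a b m A p q) := by
  have hx := growth_orderLabel h
  simp only [rowmotion, upperInvSum, tropRowmotion]
  split_ifs
  · convert ((hx p q).mul ((hx (p + 1) q).inv.add (hx p (q + 1)).inv)).inv using 1
    rw [max_neg_neg]; ring
  · convert ((hx p q).mul (hx (p + 1) q).inv).inv using 1
    ring
  · convert ((hx p q).mul (hx p (q + 1)).inv).inv using 1
    ring
  · convert ((hx p q).mul (Growth.zpow m).inv).inv using 1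
    ring

/-- Piecewise-linear rowmotion on a rectangle with sides `a + 1` and `b + 1` has order
`a + b + 2`. -/
theorem tropRowmotion_periodic (a b : ℕ) (m : ℤ) (A : ℕ → ℕ → ℤ) (p q : ℕ) (hp : p ≤ a)
    (hq : q ≤ b) : (tropRowmotion a b m)^[a + b + 2] A p q = A p q := by
  have hiter : ∀ t p q, Growth (fun s => (rowmotion a b (s ^ m))^[t] (fun p q => s ^ A p q) p q)
      ((tropRowmotion a b m)^[t] A p q) := by
    intro t
    induction t with
    | zero => exact fun p q => Growth.zpow (A p q)
    | succ t ih =>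
      intro p q
      simp only [Function.iterate_succ_apply']
      exact growth_rowmotion a b m ih p q
  refine (hiter (a + b + 2) p q).unique (hiter 0 p q) fun s hs => ?_
  have hs0 : 0 < s := by linarith
  exact rowmotion_periodic (zpow_pos hs0 m) (fun p q => zpow_pos hs0 _) p q hp hq

theorem maxPath_congr {a b : ℕ} {A A' : ℕ → ℕ → ℤ} (h : ∀ p q, p ≤ a → q ≤ b → A p q = A' p q)
    (p q : ℕ) (hp : p ≤ a) (hq : q ≤ b) : maxPath A p q = maxPath A' p q := by
  induction p, q using maxPath.induct with
  | case1 => simp only [maxPath]; exact h 0 0 hp hq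
  | case2 p ih => simp only [maxPath]; rw [h _ _ hp hq, ih (by omega) hq]
  | case3 q ih => simp only [maxPath]; rw [h _ _ hp hq, ih hp (by omega)]
  | case4 p q ih1 ih2 =>
    simp only [maxPath]; rw [h _ _ hp hq, ih1 (by omega) hq, ih2 hp (by omega)]

theorem tropRowmotion_congr {a b : ℕ} {m : ℤ} {A A' : ℕ → ℕ → ℤ}
    (h : ∀ p q, p ≤ a → q ≤ b → A p q = A' p q) (p q : ℕ) (hp : p ≤ a) (hq : q ≤ b) :
    tropRowmotion a b m A p q = tropRowmotion a b m A' p q := by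
  have hx := maxPath_congr h
  simp only [tropRowmotion]
  split_ifs
  · rw [hx p q hp hq, hx (p + 1) q (by omega) hq, hx p (q + 1) hp (by omega)]
  · rw [hx p q hp hq, hx (p + 1) q (by omega) hq]
  · rw [hx p q hp hq, hx p (q + 1) hp (by omega)]
  · rw [hx p q hp hq]

/-! ### The column step of the promotion algorithm -/

section column
variable {n : ℕ} {a c : Col}

theorem qmc_eq_of_isLeast {lo p : ℕ} (hlo : lo ≤ p) (hp : p ≤ n)
    (hmax : ∀ q ∈ Icc lo n, Gc n lo a c q ≤ Gc n lo a c p)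
    (hmin : ∀ q, lo ≤ q → q < p → Gc n lo a c q < Gc n lo a c p) : qmc n lo a c = p := by
  have hleast : IsLeast {p | p ∈ Icc lo n ∧ ∀ q ∈ Icc lo n, Gc n lo a c q ≤ Gc n lo a c p} p := by
    refine ⟨⟨mem_Icc.2 ⟨hlo, hp⟩, hmax⟩, fun q hq => ?_⟩
    by_contra! hlt
    have h1 := hmin q (mem_Icc.1 hq.1).1 hlt
    have h2 := hq.2 p (mem_Icc.2 ⟨hlo, hp⟩)
    omega
  rw [qmc, if_pos (hlo.trans hp), hleast.csInf_eq, max_eq_right hlo]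

theorem qmc_spec {lo : ℕ} (hlo : lo ≤ n) : lo ≤ qmc n lo a c ∧ qmc n lo a c ≤ n ∧
    (∀ q ∈ Icc lo n, Gc n lo a c q ≤ Gc n lo a c (qmc n lo a c)) ∧
    ∀ q, lo ≤ q → q < qmc n lo a c → Gc n lo a c q < Gc n lo a c (qmc n lo a c) := by
  set S := {p | p ∈ Icc lo n ∧ ∀ q ∈ Icc lo n, Gc n lo a c q ≤ Gc n lo a c p} with hS
  have hne : S.Nonempty := by
    obtain ⟨p, hp, h⟩ := exists_max_image (Icc lo n) (Gc n lo a c) ⟨lo, by simp [hlo]⟩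
    exact ⟨p, hp, h⟩
  have hmem := Nat.sInf_mem hne
  have hq : qmc n lo a c = sInf S := by
    rw [qmc, if_pos hlo, ← hS, max_eq_right (mem_Icc.1 hmem.1).1]
  rw [hq]
  refine ⟨(mem_Icc.1 hmem.1).1, (mem_Icc.1 hmem.1).2, hmem.2, fun q hq1 hq2 => ?_⟩
  by_contra! hle
  have hqS : q ∈ S := by
    refine ⟨mem_Icc.2 ⟨hq1, hq2.le.trans (mem_Icc.1 hmem.1).2⟩, fun r hr => ?_⟩
    exact (hmem.2 r hr).trans hle
  exact (Nat.notMem_of_lt_sInf hq2) hqS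

theorem Gc_eq {lo p : ℕ} (h0 : 1 ≤ lo) (hlo : lo ≤ p) (hp : p ≤ n) :
    Gc n lo a c p = ∑ j ∈ Icc lo p, a j - ∑ j ∈ Icc lo (p - 1), c j + ∑ j ∈ Icc lo n, c j := by
  have : ∑ j ∈ Icc lo n, c j = ∑ j ∈ Icc lo (p - 1), c j + ∑ j ∈ Icc p n, c j := by
    rw [← sum_union]
    · congr 1; ext j; simp only [mem_Icc, mem_union]; omega
    · rw [disjoint_left]; intro j; simp only [mem_Icc]; omega
  rw [Gc, this]; ring

theorem Gc_qmc {lo : ℕ} (h0 : 1 ≤ lo) (hlo : lo ≤ n) :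
    Gc n lo a c (qmc n lo a c) = epsc n lo a c + ∑ j ∈ Icc lo n, c j := by
  obtain ⟨h1, h2, -⟩ := qmc_spec (a := a) (c := c) hlo
  rw [Gc_eq h0 h1 h2, epsc]

theorem Gc_self {lo : ℕ} : Gc n lo a c lo = a lo + ∑ j ∈ Icc lo n, c j := by
  simp [Gc]

theorem sum_Icc_head {f : ℕ → ℤ} {lo p : ℕ} (h : lo ≤ p) :
    ∑ j ∈ Icc lo p, f j = f lo + ∑ j ∈ Icc (lo + 1) p, f j := by
  rw [← add_sum_Ioc_eq_sum_Icc h, Finset.Icc_add_one_left_eq_Ioc]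

theorem Gc_succ {lo p : ℕ} (hlo : lo < p) :
    Gc n lo a c p = a lo + Gc n (lo + 1) a c p := by
  rw [Gc, Gc, sum_Icc_head hlo.le]; ring

theorem qmc_self : qmc n n a c = n :=
  qmc_eq_of_isLeast le_rfl le_rfl
    (fun q hq => by rw [Icc_self, mem_singleton] at hq; rw [hq]) (fun q h1 h2 => by omega)

theorem qmc_of_le {lo : ℕ} (h0 : 1 ≤ lo) (hlo : lo < n) (h : epsc n (lo + 1) a c ≤ c lo) :
    qmc n lo a c = lo := by
  refine qmc_eq_of_isLeast le_rfl hlo.le (fun q hq => ?_) (fun q h1 h2 => by omega)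
  rw [mem_Icc] at hq
  rcases hq.1.eq_or_lt with rfl | hlt
  · rfl
  · have h1 := (qmc_spec (a := a) (c := c) (Nat.succ_le_of_lt hlo)).2.2.1 q
      (mem_Icc.2 ⟨hlt, hq.2⟩)
    rw [Nat.succ_eq_add_one, Gc_qmc (by omega) (by omega)] at h1
    rw [Gc_self, Gc_succ hlt, sum_Icc_head hlo.le]
    linarith

theorem qmc_of_lt_s19 {lo : ℕ} (h0 : 1 ≤ lo) (hlo : lo < n) (h : c lo < epsc n (lo + 1) a c) :
    qmc n lo a c = qmc n (lo + 1) a c := by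
  obtain ⟨s1, s2, s3, s4⟩ := qmc_spec (a := a) (c := c) (Nat.succ_le_of_lt hlo)
  rw [Nat.succ_eq_add_one] at s1 s2 s3 s4
  have hself : Gc n lo a c lo < Gc n lo a c (qmc n (lo + 1) a c) := by
    rw [Gc_self, Gc_succ (by omega), Gc_qmc (by omega) (by omega), sum_Icc_head hlo.le]
    linarith
  refine qmc_eq_of_isLeast (by omega) s2 (fun q hq => ?_) (fun q h1 h2 => ?_)
  · rw [mem_Icc] at hq
    rcases hq.1.eq_or_lt with rfl | hlt
    · exact hself.le
    · rw [Gc_succ hlt, Gc_succ (by omega : lo < qmc n (lo + 1) a c)]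
      have := s3 q (mem_Icc.2 ⟨hlt, hq.2⟩)
      linarith
  · rcases h1.eq_or_lt with rfl | hlt
    · exact hself
    · rw [Gc_succ hlt, Gc_succ (by omega : lo < qmc n (lo + 1) a c)]
      have := s4 q hlt h2
      linarith

theorem epsc_self (h0 : 1 ≤ n) : epsc n n a c = a n := by
  have : Icc n (n - 1) = ∅ := by ext; simp only [mem_Icc, notMem_empty, iff_false]; omega
  rw [epsc, qmc_self, this]; simp

theorem epsc_step {lo : ℕ} (h0 : 1 ≤ lo) (hlo : lo < n) :
    epsc n lo a c = a lo + max 0 (epsc n (lo + 1) a c - c lo) := by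
  have hG := Gc_qmc (a := a) (c := c) h0 hlo.le
  have hG' := Gc_qmc (a := a) (c := c) (Nat.le_add_left 1 lo) hlo
  have hs := sum_Icc_head (f := c) hlo.le
  rcases le_or_gt (epsc n (lo + 1) a c) (c lo) with h | h
  · rw [qmc_of_le h0 hlo h, Gc_self] at hG
    rw [max_eq_left (by linarith)]; linarith
  · rw [qmc_of_lt_s19 h0 hlo h, Gc_succ (qmc_spec (a := a) (c := c) (Nat.succ_le_of_lt hlo)).1,
      hG'] at hG
    rw [max_eq_right (by linarith)]; linarith

/-- The minimal maximizer is the first row `≥ lo` at which the walk stops. -/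
theorem qmc_isLeast {lo : ℕ} (h0 : 1 ≤ lo) (hlo : lo ≤ n) :
    IsLeast {p | lo ≤ p ∧ p ≤ n ∧ (p < n → epsc n (p + 1) a c ≤ c p)} (qmc n lo a c) := by
  induction h : n - lo generalizing lo with
  | zero =>
    obtain rfl : lo = n := by omega
    rw [qmc_self]
    exact ⟨⟨le_rfl, le_rfl, fun h => absurd h (lt_irrefl _)⟩, fun p hp => hp.1⟩
  | succ d ih =>
    have hlt : lo < n := by omega
    rcases le_or_gt (epsc n (lo + 1) a c) (c lo) with h1 | h1
    · rw [qmc_of_le h0 hlt h1]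
      exact ⟨⟨le_rfl, hlo, fun _ => h1⟩, fun p hp => hp.1⟩
    · rw [qmc_of_lt_s19 h0 hlt h1]
      obtain ⟨⟨g1, g2, g3⟩, g4⟩ := ih (lo := lo + 1) (by omega) hlt (by omega)
      refine ⟨⟨by omega, g2, g3⟩, fun p hp => g4 ⟨?_, hp.2.1, hp.2.2⟩⟩
      rcases hp.1.eq_or_lt with rfl | h2
      · exact absurd (hp.2.2 hlt) (by omega)
      · exact h2

theorem mem_lset {i r : ℕ} (h0 : 1 ≤ i) (hir : i ≤ r) (hr : r < n) :
    r ∈ lset n i a c ↔ epsc n (r + 1) a c ≤ c r := by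
  simp only [lset, mem_image, mem_range]
  constructor
  · rintro ⟨s, -, rfl⟩
    have key : ∀ lo, 1 ≤ lo → qmc n lo a c < n →
        epsc n (qmc n lo a c + 1) a c ≤ c (qmc n lo a c) := by
      intro lo h1 h2
      rcases le_or_gt lo n with h3 | h3
      · exact (qmc_isLeast h1 h3).1.2.2 h2
      · rw [qmc, if_neg (by omega)] at h2; omega
    cases s with
    | zero => exact key i h0 hr
    | succ s => exact key _ (by omega) hr
  · intro h
    by_contra! hne
    have key : ∀ s, s ≤ n → i + s ≤ lfun n i a c s ∧ lfun n i a c s < r := by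
      intro s hs
      induction s with
      | zero =>
        have h1 := qmc_isLeast (a := a) (c := c) h0 (hir.trans hr.le)
        have h2 := h1.1.1
        have h3 := h1.2 ⟨hir, hr.le, fun _ => h⟩
        have h4 := hne 0 (by omega)
        simp only [lfun] at h4 ⊢
        omega
      | succ s ih =>
        obtain ⟨i1, i2⟩ := ih (by omega)
        have h1 := qmc_isLeast (a := a) (c := c) (lo := lfun n i a c s + 1) (n := n) (by omega)
          (by omega)
        have h2 := h1.1.1
        have h3 := h1.2 ⟨i2, hr.le, fun _ => h⟩
        have h4 := hne (s + 1) (by omega)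
        simp only [lfun] at h4 ⊢
        omega
    have := key n le_rfl
    omega

theorem hatc_of_lt {i r : ℕ} (h0 : 1 ≤ i) (hir : i ≤ r) (hr : r < n) :
    hatc n i a c r = a r + max 0 (c r - epsc n (r + 1) a c) := by
  rw [hatc, if_neg hr.ne]
  simp only [mem_lset (a := a) (c := c) h0 hir hr]
  split_ifs with h
  · rw [max_eq_right (by linarith)]; ring
  · rw [max_eq_left (by linarith)]; ring

theorem prcol_succ {i r : ℕ} (h0 : 1 ≤ i) (hir : i ≤ r) (hr : r < n) :
    prcol n i a c (r + 1) = min (epsc n (r + 1) a c) (c r) := by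
  rw [prcol, if_neg (by omega), Nat.add_sub_cancel]
  simp only [mem_lset (a := a) (c := c) h0 hir hr]
  split_ifs with h
  · rw [min_eq_left h]
  · rw [min_eq_right (by linarith)]

end column

/-! ### Promotion is piecewise-linear rowmotion -/

/-- The array read from its bottom right corner `(i, n)`. -/
def rev (n i : ℕ) (A : Arr) : ℕ → ℕ → ℤ := fun p q => A (i - p) (n - q)

section promotion
variable {n i : ℕ} {A : Arr}

theorem epsc_eq_of_column {c : Col} (hi : 1 ≤ i) (k : ℕ)
    (hc : ∀ q, q < n - i →
      c (n - (q + 1)) = maxPath (rev n i A) k (q + 1) - maxPath (rev n i A) k q)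
    (hin : i ≤ n) (q : ℕ) (hq : q ≤ n - i) :
    epsc n (n - q) (fun r => A (i - 1 - k) r) c =
      maxPath (rev n i A) (k + 1) q - maxPath (rev n i A) k q := by
  have hk : i - 1 - k = i - (k + 1) := by omega
  induction q with
  | zero =>
    rw [Nat.sub_zero, epsc_self (by omega), maxPath, rev, hk, Nat.sub_zero]; ring
  | succ q ih =>
    rw [epsc_step (by omega) (by omega), show n - (q + 1) + 1 = n - q by omega, ih (by omega),
      hc q (by omega), maxPath, rev, hk]
    omega

theorem cseq_eq (hi : 1 ≤ i) (hin : i ≤ n) (k : ℕ) :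
    cseq n i A k n = maxPath (rev n i A) k 0 ∧ ∀ q, q < n - i →
      cseq n i A k (n - (q + 1)) =
        maxPath (rev n i A) k (q + 1) - maxPath (rev n i A) k q := by
  induction k with
  | zero =>
    refine ⟨by simp [cseq, maxPath, rev], fun q hq => ?_⟩
    simp [cseq, maxPath, rev]
  | succ k ih =>
    have hk : i - 1 - k = i - (k + 1) := by omega
    obtain ⟨h0, h1⟩ := ih
    constructor
    · rw [cseq, hatc, if_pos rfl, h0, maxPath, rev, hk, Nat.sub_zero]
    · intro q hq
      have he := epsc_eq_of_column hi k h1 hin q (by omega)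
      rw [cseq, hatc_of_lt hi (by omega) (by omega), show n - (q + 1) + 1 = n - q by omega, he,
        h1 q hq, maxPath, rev, hk]
      omega

theorem prColJ_bottom (hi : 1 ≤ i) (hin : i ≤ n) (k : ℕ) (hk : k < i) :
    prColJ n i A (i - k) i =
      maxPath (rev n i A) (k + 1) (n - i) - maxPath (rev n i A) k (n - i) := by
  obtain ⟨-, h1⟩ := cseq_eq (A := A) hi hin k
  have he := epsc_eq_of_column hi k h1 hin (n - i) le_rfl
  rw [Nat.sub_sub_self hin] at he
  rw [prColJ, prcol, if_pos rfl, Nat.sub_sub_self hk.le, ← he, Nat.sub_right_comm]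

theorem prColJ_of_lt (hi : 1 ≤ i) (hin : i ≤ n) (k q : ℕ) (hk : k < i) (hq : q < n - i) :
    prColJ n i A (i - k) (n - q) =
      min (maxPath (rev n i A) (k + 1) q) (maxPath (rev n i A) k (q + 1)) -
        maxPath (rev n i A) k q := by
  obtain ⟨-, h1⟩ := cseq_eq (A := A) hi hin k
  have he := epsc_eq_of_column hi k h1 hin q hq.le
  rw [prColJ, Nat.sub_sub_self hk.le, show n - q = n - (q + 1) + 1 by omega,
    prcol_succ hi (by omega) (by omega), h1 q hq, show n - (q + 1) + 1 = n - q by omega,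
    Nat.sub_right_comm, he]
  omega

theorem sum_Icc_reflect (f : ℕ → ℤ) {d i : ℕ} (hd : d ≤ i) :
    ∑ j ∈ Icc (d + 1) i, f j = ∑ k ∈ range (i - d), f (i - k) := by
  refine sum_nbij' (fun j => i - j) (fun k => i - k) ?_ ?_ ?_ ?_ ?_
  all_goals intro j hj; simp only [mem_Icc, mem_range] at hj ⊢
  · omega
  · omega
  · omega
  · omega
  · rw [Nat.sub_sub_self hj.2]

theorem sum_rev_zero (q : ℕ) :
    ∑ k ∈ range (q + 1), rev n i A 0 k = maxPath (rev n i A) 0 q := by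
  induction q with
  | zero => simp [maxPath]
  | succ q ih => rw [sum_range_succ, ih, maxPath]; ring

theorem sum_rev_sub (x : ℕ → ℕ → ℤ) (q k : ℕ) :
    ∑ j ∈ range (k + 1), x j (q + 1) -
      ∑ j ∈ range k, (min (maxPath x (j + 1) q) (maxPath x j (q + 1)) - maxPath x j q) =
    maxPath x k (q + 1) - maxPath x k q := by
  induction k with
  | zero => simp [maxPath]
  | succ k ih =>
    rw [sum_range_succ, sum_range_succ (fun j => _ - _), maxPath]
    omega

theorem rev_prMap (m : ℕ) (hi : 2 ≤ i) (hin : i ≤ n) (p q : ℕ) (hp : p ≤ i - 1)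
    (hq : q ≤ n - i) :
    rev n i (prMap n i m A) p q = tropRowmotion (i - 1) (n - i) m (rev n i A) p q := by
  rw [rev, prMap, if_pos (by omega), tropRowmotion]
  rcases hp.lt_or_eq with hp | rfl
  · rw [if_neg (by omega), if_pos hp]
    rcases hq.lt_or_eq with hq | rfl
    · rw [if_pos hq, prColJ_of_lt (by omega) hin p q (by omega) hq]
    · rw [if_neg (by omega), Nat.sub_sub_self hin, prColJ_bottom (by omega) hin p (by omega)]
  · rw [if_pos (by omega), if_neg (lt_irrefl _)]
    rcases hq.lt_or_eq with hq | rfl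
    · rw [if_neg (by omega), if_pos hq, sum_Icc_reflect _ (by omega : 0 ≤ i),
        sum_Icc_reflect _ (by omega : 1 ≤ i), ← sum_rev_sub, Nat.sub_zero,
        show i - 1 + 1 = i by omega]
      congr 1
      refine sum_congr rfl fun k hk => ?_
      rw [mem_range] at hk
      exact prColJ_of_lt (by omega) hin k q (by omega) hq
    · have h1 : ∑ j ∈ Icc i n, A i j = maxPath (rev n i A) 0 (n - i) := by
        obtain ⟨d, rfl⟩ : ∃ d, i = d + 1 := ⟨i - 1, by omega⟩
        rw [sum_Icc_reflect _ (by omega), ← sum_rev_zero]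
        rw [show n - (d + 1) + 1 = n - d by omega]
        rfl
      have h2 : ∑ j ∈ Icc 2 i, prColJ n i A j i =
          maxPath (rev n i A) (i - 1) (n - i) - maxPath (rev n i A) 0 (n - i) := by
        rw [sum_Icc_reflect _ (by omega : 1 ≤ i),
          ← sum_range_sub (fun k => maxPath (rev n i A) k (n - i))]
        refine sum_congr rfl fun k hk => ?_
        rw [mem_range] at hk
        exact prColJ_bottom (by omega) hin k (by omega)
      rw [if_pos (by omega), if_neg (lt_irrefl _), h1, h2]
      ring

end promotion

/-- The promotion map satisfies `pr^{n+1} = id` on `B^{m,i}`;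
equivalently, the inverse of `pr` is `pr^n`. -/
theorem stmt19 (n i m : ℕ) (hi : 2 ≤ i) (hin : i ≤ n) (A : Arr) (hA : InB n i m A) :
    (prMap n i m)^[n + 1] A = A ∧ (prMap n i m)^[n] (prMap n i m A) = A := by
  suffices h : (prMap n i m)^[n + 1] A = A from ⟨h, by rwa [← Function.iterate_succ_apply]⟩
  have hiter : ∀ t p q, p ≤ i - 1 → q ≤ n - i → rev n i ((prMap n i m)^[t] A) p q =
      (tropRowmotion (i - 1) (n - i) m)^[t] (rev n i A) p q := by
    intro t
    induction t with
    | zero => exact fun p q _ _ => rfl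
    | succ t ih =>
      intro p q hp hq
      rw [Function.iterate_succ_apply', Function.iterate_succ_apply', rev_prMap m hi hin p q hp hq]
      exact tropRowmotion_congr ih p q hp hq
  funext p r
  by_cases hbox : 1 ≤ p ∧ p ≤ i ∧ i ≤ r ∧ r ≤ n
  · have h1 := hiter (n + 1) (i - p) (n - r) (by omega) (by omega)
    have h2 := tropRowmotion_periodic (i - 1) (n - i) m (rev n i A) (i - p) (n - r) (by omega)
      (by omega)
    rw [show i - 1 + (n - i) + 2 = n + 1 by omega, ← h1] at h2
    simpa only [rev, Nat.sub_sub_self hbox.2.1, Nat.sub_sub_self hbox.2.2.2] using h2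
  · rw [hA.2.1 p r hbox, Function.iterate_succ_apply', prMap, if_neg hbox]

end KR
end
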